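/- For each j with 1 ≤ j ≤ n−1, the intersection e_j(A#C_n) ∩ (e₀) equals {e_j a : a ∈ R_j A}, where R_j A is the right ideal of A generated by R_j (A being viewed as a subalgebra of A#C_n). -/

import Mathlib

open scoped BigOperators

namespace NCIS

variable (k : Type*) [Field k] (n : ℕ)

/-- Relations defining the skew group algebra `A # C_n`, where
`A = k_{-1}[x_0, …, x_{n-1}]`: the generators are `x_i` (`Sum.inl i`) and `s` (`Sum.inr ()`),
subject to `x_i x_j + x_j x_i = 0` for `i ≠ j`, `s^n = 1` and `s x_i = x_{i+1} s`. -/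
inductive SGRel : FreeAlgebra k (ZMod n ⊕ Unit) → FreeAlgebra k (ZMod n ⊕ Unit) → Prop
  | anti (i j : ZMod n) (h : i ≠ j) :
      SGRel (FreeAlgebra.ι k (Sum.inl i) * FreeAlgebra.ι k (Sum.inl j)
           + FreeAlgebra.ι k (Sum.inl j) * FreeAlgebra.ι k (Sum.inl i)) 0
  | spow : SGRel (FreeAlgebra.ι k (Sum.inr ()) ^ n) 1
  | scomm (i : ZMod n) :
      SGRel (FreeAlgebra.ι k (Sum.inr ()) * FreeAlgebra.ι k (Sum.inl i))
            (FreeAlgebra.ι k (Sum.inl (i + 1)) * FreeAlgebra.ι k (Sum.inr ()))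

/-- The skew group algebra `A # C_n`. -/
abbrev SkewGroup := RingQuot (SGRel k n)

/-- The image of the generator `x_i` in `A # C_n`. -/
noncomputable def xg (i : ZMod n) : SkewGroup k n :=
  RingQuot.mkAlgHom k (SGRel k n) (FreeAlgebra.ι k (Sum.inl i))

/-- The image of the generator `s` in `A # C_n`. -/
noncomputable def sg : SkewGroup k n :=
  RingQuot.mkAlgHom k (SGRel k n) (FreeAlgebra.ι k (Sum.inr ()))

/-- The integral `e₀ = (1/n) ∑_{i=0}^{n-1} s^i` in `A # C_n`. -/
noncomputable def e0 : SkewGroup k n := (n : k)⁻¹ • ∑ i ∈ Finset.range n, sg k n ^ i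

/-- The quotient algebra `E = (A # C_n)/(e₀)` of `A # C_n` by the two-sided ideal
generated by `e₀`. -/
abbrev Equot := RingQuot (fun a b : SkewGroup k n => a = e0 k n ∧ b = 0)

end NCIS

namespace NCIS

variable (k : Type*) [Field k] (n : ℕ)

/-- The eigenvector `b_γ = (1/n) ∑_{i=0}^{n-1} ω^{iγ} x_i` in `A ⊆ A # C_n`. -/
noncomputable def bg (ω : k) (γ : ZMod n) : SkewGroup k n :=
  (n : k)⁻¹ • ∑ i ∈ Finset.range n, ω ^ (i * γ.val) • xg k n (i : ZMod n)

/-- The central element `c_j = (2/n²) ∑_{i=0}^{n-1} ω^{ij} x_i²` of `A ⊆ A # C_n`. -/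
noncomputable def cg (ω : k) (j : ZMod n) : SkewGroup k n :=
  (2 / (n : k) ^ 2) • ∑ i ∈ Finset.range n, ω ^ (i * j.val) • xg k n (i : ZMod n) ^ 2

/-- The idempotent `e_α = (1/n) ∑_{i=0}^{n-1} (ω^α s)^i` in `A # C_n`. -/
noncomputable def eg (ω : k) (α : ZMod n) : SkewGroup k n :=
  (n : k)⁻¹ • ∑ i ∈ Finset.range n, (ω ^ α.val • sg k n) ^ i

end NCIS

namespace NCIS

variable (k : Type*) [Field k] (n : ℕ)

/-- Relations defining the `(-1)`-skew polynomial ring `A = k_{-1}[x_0, …, x_{n-1}]`: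
`x_i x_j + x_j x_i = 0` for all `i ≠ j` in `ℤ/n`. -/
inductive ARel : FreeAlgebra k (ZMod n) → FreeAlgebra k (ZMod n) → Prop
  | anti (i j : ZMod n) (h : i ≠ j) :
      ARel (FreeAlgebra.ι k i * FreeAlgebra.ι k j + FreeAlgebra.ι k j * FreeAlgebra.ι k i) 0

/-- The `(-1)`-skew polynomial ring `A = k_{-1}[x_0, …, x_{n-1}]`. -/
abbrev SkewPoly := RingQuot (ARel k n)

/-- The image of the generator `x_i` in `A`. -/
noncomputable def xA (i : ZMod n) : SkewPoly k n :=
  RingQuot.mkAlgHom k (ARel k n) (FreeAlgebra.ι k i)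

/-- The eigenvector `b_γ = (1/n) ∑_{i=0}^{n-1} ω^{iγ} x_i ∈ A`. -/
noncomputable def bA (ω : k) (γ : ZMod n) : SkewPoly k n :=
  (n : k)⁻¹ • ∑ i ∈ Finset.range n, ω ^ (i * γ.val) • xA k n (i : ZMod n)

/-- The central element `c_j = (2/n²) ∑_{i=0}^{n-1} ω^{ij} x_i² ∈ A`. -/
noncomputable def cA (ω : k) (j : ZMod n) : SkewPoly k n :=
  (2 / (n : k) ^ 2) • ∑ i ∈ Finset.range n, ω ^ (i * j.val) • xA k n (i : ZMod n) ^ 2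

/-- The algebra automorphism `σ` of `A` determined by `σ(x_i) = x_{i+1}`, generating the
action of the cyclic group `C_n` on `A`. -/
noncomputable def sigmaA : SkewPoly k n →ₐ[k] SkewPoly k n :=
  RingQuot.liftAlgHom k
    ⟨(RingQuot.mkAlgHom k (ARel k n)).comp
        (FreeAlgebra.lift k (fun i : ZMod n => FreeAlgebra.ι k (i + 1))), by
      intro x y h
      induction h with
      | anti i j hij =>
        have hne : i + 1 ≠ j + 1 := fun hc => hij (by exact add_left_injective 1 hc)
        have := RingQuot.mkAlgHom_rel k (ARel.anti (k := k) (n := n) (i + 1) (j + 1) hne)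
        simpa using this⟩

/-- The `ω^{-j}`-eigenspace `R_j = {a ∈ A : σ·a = ω^{−j} a}` of the `C_n`-action on `A`. -/
def Rcomp (ω : k) (j : ZMod n) : Set (SkewPoly k n) :=
  {a : SkewPoly k n | sigmaA k n a = (ω ^ j.val)⁻¹ • a}

/-- The right ideal `R_j A` of `A` generated by `R_j`. -/
noncomputable def RcompA (ω : k) (j : ZMod n) : Submodule k (SkewPoly k n) :=
  Submodule.span k {y : SkewPoly k n | ∃ r ∈ Rcomp k n ω j, ∃ a : SkewPoly k n, y = r * a}

end NCIS

namespace NCIS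

variable (k : Type*) [Field k] (n : ℕ)

/-- The natural embedding `A → A # C_n`, `x_i ↦ x_i`. -/
noncomputable def iotaA : SkewPoly k n →ₐ[k] SkewGroup k n :=
  RingQuot.liftAlgHom k
    ⟨(RingQuot.mkAlgHom k (SGRel k n)).comp
        (FreeAlgebra.lift k (fun i : ZMod n => FreeAlgebra.ι k (Sum.inl i))), by
      intro x y h
      induction h with
      | anti i j hij =>
        have := RingQuot.mkAlgHom_rel k (SGRel.anti (k := k) (n := n) i j hij)
        simpa using this⟩

end NCIS

section GeomSum

variable {R : Type*} [Semiring R] {t : R} {n : ℕ}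

theorem mul_geom_sum_of_pow_eq_one (ht : t ^ n = 1) :
    t * ∑ i ∈ Finset.range n, t ^ i = ∑ i ∈ Finset.range n, t ^ i := by
  cases n with
  | zero => simp
  | succ m =>
    simp_rw [Finset.mul_sum, ← pow_succ']
    rw [Finset.sum_range_succ, ht, Finset.sum_range_succ', pow_zero]

theorem geom_sum_mul_of_pow_eq_one (ht : t ^ n = 1) :
    (∑ i ∈ Finset.range n, t ^ i) * t = ∑ i ∈ Finset.range n, t ^ i := by
  rw [← (Commute.sum_right _ _ _ fun i _ => Commute.self_pow t i).eq,
    mul_geom_sum_of_pow_eq_one ht]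

theorem geom_sum_mul_self_of_pow_eq_one (ht : t ^ n = 1) :
    (∑ i ∈ Finset.range n, t ^ i) * ∑ i ∈ Finset.range n, t ^ i =
      (n : R) * ∑ i ∈ Finset.range n, t ^ i := by
  have h : ∀ m : ℕ, t ^ m * ∑ i ∈ Finset.range n, t ^ i = ∑ i ∈ Finset.range n, t ^ i := by
    intro m
    induction m with
    | zero => simp
    | succ m ih => rw [pow_succ, mul_assoc, mul_geom_sum_of_pow_eq_one ht, ih]
  rw [Finset.sum_mul, Finset.sum_congr rfl fun i _ => h i]
  simp

end GeomSum

namespace NCIS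

section

variable {k : Type*} [Field k] {n : ℕ}

theorem sigmaA_xA (i : ZMod n) : sigmaA k n (xA k n i) = xA k n (i + 1) := by
  simp [sigmaA, xA]

theorem iotaA_xA (i : ZMod n) : iotaA k n (xA k n i) = xg k n i := by
  simp [iotaA, xA, xg]

theorem sg_pow_n : sg k n ^ n = 1 := by
  simpa [sg] using RingQuot.mkAlgHom_rel k (SGRel.spow (k := k) (n := n))

theorem sg_mul_xg (i : ZMod n) : sg k n * xg k n i = xg k n (i + 1) * sg k n := by
  simpa [sg, xg] using RingQuot.mkAlgHom_rel k (SGRel.scomm (k := k) (n := n) i)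

@[elab_as_elim]
theorem SkewPoly.induction {P : SkewPoly k n → Prop} (a : SkewPoly k n)
    (algebraMap : ∀ c : k, P (algebraMap k _ c)) (xA : ∀ i, P (xA k n i))
    (mul : ∀ a b, P a → P b → P (a * b)) (add : ∀ a b, P a → P b → P (a + b)) : P a := by
  obtain ⟨f, rfl⟩ := RingQuot.mkAlgHom_surjective k (ARel k n) a
  induction f with
  | grade0 c => simpa using algebraMap c
  | grade1 i => exact xA i
  | mul f g hf hg => simpa using mul _ _ hf hg
  | add f g hf hg => simpa using add _ _ hf hg

@[elab_as_elim]
theorem SkewGroup.induction {P : SkewGroup k n → Prop} (u : SkewGroup k n)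
    (algebraMap : ∀ c : k, P (algebraMap k _ c)) (xg : ∀ i, P (xg k n i)) (sg : P (sg k n))
    (mul : ∀ u v, P u → P v → P (u * v)) (add : ∀ u v, P u → P v → P (u + v)) : P u := by
  obtain ⟨f, rfl⟩ := RingQuot.mkAlgHom_surjective k (SGRel k n) u
  induction f with
  | grade0 c => simpa using algebraMap c
  | grade1 i =>
    rcases i with i | ⟨⟩
    · exact xg i
    · exact sg
  | mul f g hf hg => simpa using mul _ _ hf hg
  | add f g hf hg => simpa using add _ _ hf hg

theorem sg_mul_iotaA (a : SkewPoly k n) :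
    sg k n * iotaA k n a = iotaA k n (sigmaA k n a) * sg k n := by
  induction a using SkewPoly.induction with
  | algebraMap c => simpa using (Algebra.commutes c (sg k n)).symm
  | xA i => rw [sigmaA_xA, iotaA_xA, iotaA_xA, sg_mul_xg]
  | mul a b ha hb => rw [map_mul, map_mul, map_mul, ← mul_assoc, ha, mul_assoc, hb, mul_assoc]
  | add a b ha hb => rw [map_add, map_add, map_add, mul_add, ha, hb, add_mul]

theorem sigmaA_pow_xA (m : ℕ) (i : ZMod n) :
    (sigmaA k n ^ m) (xA k n i) = xA k n (i + m) := by
  induction m with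
  | zero => simp
  | succ m ih => rw [pow_succ', AlgHom.mul_apply, ih, sigmaA_xA, Nat.cast_succ, add_assoc]

theorem sigmaA_pow_n : sigmaA k n ^ n = 1 := by
  refine AlgHom.ext fun a => ?_
  induction a using SkewPoly.induction with
  | algebraMap c => simp only [AlgHom.commutes]
  | xA i => simp [sigmaA_pow_xA]
  | mul a b ha hb => rw [map_mul, map_mul, ha, hb]
  | add a b ha hb => rw [map_add, map_add, ha, hb]

theorem sigmaA_surjective (hn : n ≠ 0) : Function.Surjective (sigmaA k n) := fun a =>
  ⟨(sigmaA k n ^ (n - 1)) a, by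
    rw [← AlgHom.mul_apply, mul_pow_sub_one hn, sigmaA_pow_n, AlgHom.one_apply]⟩

theorem sg_mul_e0 : sg k n * e0 k n = e0 k n := by
  rw [e0, mul_smul_comm, mul_geom_sum_of_pow_eq_one sg_pow_n]

theorem e0_mul_sg : e0 k n * sg k n = e0 k n := by
  rw [e0, smul_mul_assoc, geom_sum_mul_of_pow_eq_one sg_pow_n]

theorem exists_mul_e0_eq (u : SkewGroup k n) :
    ∃ a : SkewPoly k n, u * e0 k n = iotaA k n a * e0 k n := by
  suffices h : ∀ w, ∃ a, u * (iotaA k n w * e0 k n) = iotaA k n a * e0 k n by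
    simpa using h 1
  induction u using SkewGroup.induction with
  | algebraMap c => exact fun w => ⟨algebraMap k _ c * w, by simp [mul_assoc]⟩
  | xg i => exact fun w => ⟨xA k n i * w, by rw [map_mul, iotaA_xA, mul_assoc]⟩
  | sg => exact fun w => ⟨sigmaA k n w, by
      rw [← mul_assoc, sg_mul_iotaA, mul_assoc, sg_mul_e0]⟩
  | mul u v hu hv =>
    intro w
    obtain ⟨a, ha⟩ := hv w
    obtain ⟨b, hb⟩ := hu a
    exact ⟨b, by rw [mul_assoc, ha, hb]⟩
  | add u v hu hv =>
    intro w
    obtain ⟨a, ha⟩ := hu w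
    obtain ⟨b, hb⟩ := hv w
    exact ⟨a + b, by rw [add_mul, ha, hb, map_add, add_mul]⟩

theorem exists_e0_mul_eq (hn : n ≠ 0) (v : SkewGroup k n) :
    ∃ a : SkewPoly k n, e0 k n * v = e0 k n * iotaA k n a := by
  suffices h : ∀ w, ∃ a, e0 k n * iotaA k n w * v = e0 k n * iotaA k n a by
    simpa using h 1
  induction v using SkewGroup.induction with
  | algebraMap c => exact fun w => ⟨w * algebraMap k _ c, by simp [mul_assoc]⟩
  | xg i => exact fun w => ⟨w * xA k n i, by rw [map_mul, iotaA_xA, mul_assoc]⟩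
  | sg =>
    intro w
    obtain ⟨a, rfl⟩ := sigmaA_surjective hn w
    exact ⟨a, by rw [mul_assoc, ← sg_mul_iotaA, ← mul_assoc, e0_mul_sg]⟩
  | mul u v hu hv =>
    intro w
    obtain ⟨a, ha⟩ := hu w
    obtain ⟨b, hb⟩ := hv a
    exact ⟨b, by rw [← mul_assoc, ha, hb]⟩
  | add u v hu hv =>
    intro w
    obtain ⟨a, ha⟩ := hu w
    obtain ⟨b, hb⟩ := hv w
    exact ⟨a + b, by rw [mul_add, ha, hb, map_add, mul_add]⟩

variable {ω : k}

theorem smul_sg_pow_n (hω : ω ^ n = 1) (j : ZMod n) : (ω ^ j.val • sg k n) ^ n = 1 := by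
  rw [smul_pow, sg_pow_n, ← pow_mul, mul_comm, pow_mul, hω, one_pow, one_smul]

theorem eg_mul_self (hω : ω ^ n = 1) (hn : (n : k) ≠ 0) (j : ZMod n) :
    eg k n ω j * eg k n ω j = eg k n ω j := by
  rw [eg, smul_mul_smul_comm, geom_sum_mul_self_of_pow_eq_one (smul_sg_pow_n hω j),
    ← nsmul_eq_mul, ← Nat.cast_smul_eq_nsmul k, smul_smul, inv_mul_cancel_right₀ hn]

/-- The projection `(1/n) ∑ᵢ ω^{ij} σ^i` of `A` onto `R_j`. -/
noncomputable def projR (ω : k) (j : ZMod n) : Module.End k (SkewPoly k n) :=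
  (n : k)⁻¹ • ∑ i ∈ Finset.range n, (ω ^ j.val • (sigmaA k n).toLinearMap) ^ i

theorem projR_mem_Rcomp (hω : ω ^ n = 1) (hn : n ≠ 0) (j : ZMod n) (a : SkewPoly k n) :
    projR ω j a ∈ Rcomp k n ω j := by
  have hσ : (sigmaA k n).toLinearMap ^ n = 1 := by
    ext b
    rw [Module.End.pow_apply, Module.End.one_apply, AlgHom.coe_toLinearMap, ← AlgHom.coe_pow,
      sigmaA_pow_n, AlgHom.one_apply]
  have ht : (ω ^ j.val • (sigmaA k n).toLinearMap) ^ n = 1 := by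
    rw [smul_pow, hσ, ← pow_mul, mul_comm, pow_mul, hω, one_pow, one_smul]
  have hfix : (ω ^ j.val • (sigmaA k n).toLinearMap) * projR ω j = projR ω j := by
    rw [projR, mul_smul_comm, mul_geom_sum_of_pow_eq_one ht]
  have h0 : ω ^ j.val ≠ 0 := pow_ne_zero _ ((IsUnit.of_pow_eq_one hω hn).ne_zero)
  exact (eq_inv_smul_iff₀ h0).2 (LinearMap.congr_fun hfix a)

theorem eg_mul_iotaA_mul_e0 (j : ZMod n) (a : SkewPoly k n) :
    eg k n ω j * (iotaA k n a * e0 k n) = iotaA k n (projR ω j a) * e0 k n := by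
  have h : ∀ i : ℕ, (ω ^ j.val • sg k n) ^ i * (iotaA k n a * e0 k n) =
      iotaA k n (((ω ^ j.val • (sigmaA k n).toLinearMap) ^ i) a) * e0 k n := by
    intro i
    induction i with
    | zero => simp
    | succ i ih =>
      rw [pow_succ', pow_succ', mul_assoc, ih, ← mul_assoc, smul_mul_assoc, sg_mul_iotaA,
        smul_mul_assoc, mul_assoc, sg_mul_e0]
      simp
  simp only [eg, projR, smul_mul_assoc, Finset.sum_mul, h, LinearMap.smul_apply, map_smul,
    LinearMap.sum_apply, map_sum]

theorem eg_mul_iotaA_of_mem (h0 : ω ≠ 0) {j : ZMod n} {r : SkewPoly k n}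
    (hr : r ∈ Rcomp k n ω j) : eg k n ω j * iotaA k n r = iotaA k n r * e0 k n := by
  have hsr : SemiconjBy (iotaA k n r) (sg k n) (ω ^ j.val • sg k n) := by
    have hr' : sigmaA k n r = (ω ^ j.val)⁻¹ • r := hr
    rw [SemiconjBy, smul_mul_assoc, sg_mul_iotaA, hr', map_smul, smul_mul_assoc,
      smul_inv_smul₀ (pow_ne_zero _ h0)]
  rw [eg, e0, smul_mul_assoc, mul_smul_comm, Finset.sum_mul, Finset.mul_sum]
  exact congrArg _ (Finset.sum_congr rfl fun i _ => (hsr.pow_right i).eq.symm)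

theorem eg_mul_iotaA_mem_span (h0 : ω ≠ 0) {j : ZMod n} {a : SkewPoly k n}
    (ha : a ∈ RcompA k n ω j) :
    eg k n ω j * iotaA k n a ∈ TwoSidedIdeal.span {e0 k n} := by
  have he : e0 k n ∈ TwoSidedIdeal.span {e0 k n} := TwoSidedIdeal.subset_span rfl
  induction ha using Submodule.span_induction with
  | mem y hy =>
    obtain ⟨r, hr, b, rfl⟩ := hy
    rw [map_mul, ← mul_assoc, eg_mul_iotaA_of_mem h0 hr]
    exact TwoSidedIdeal.mul_mem_right _ _ _ (TwoSidedIdeal.mul_mem_left _ _ _ he)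
  | zero => simp
  | add a b _ _ ha hb => simpa [mul_add] using TwoSidedIdeal.add_mem _ ha hb
  | smul c a _ ha =>
    rw [map_smul, Algebra.smul_def, Algebra.left_comm]
    exact TwoSidedIdeal.mul_mem_left _ _ _ ha

theorem exists_eg_mul_eq_of_mem_span (hω : ω ^ n = 1) (hn : n ≠ 0) (j : ZMod n)
    {y : SkewGroup k n} (hy : y ∈ TwoSidedIdeal.span {e0 k n}) :
    ∃ a ∈ RcompA k n ω j, eg k n ω j * y = eg k n ω j * iotaA k n a := by
  have h0 : ω ≠ 0 := (IsUnit.of_pow_eq_one hω hn).ne_zero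
  rw [TwoSidedIdeal.mem_span_iff_mem_addSubgroup_closure] at hy
  induction hy using AddSubgroup.closure_induction with
  | mem y hy =>
    obtain ⟨_, ⟨u, -, _, rfl, rfl⟩, v, -, rfl⟩ := hy
    obtain ⟨a, ha⟩ := exists_mul_e0_eq u
    obtain ⟨b, hb⟩ := exists_e0_mul_eq hn v
    have hr := projR_mem_Rcomp hω hn j a
    refine ⟨projR ω j a * b, Submodule.subset_span ⟨_, hr, b, rfl⟩, ?_⟩
    dsimp only
    rw [ha, ← mul_assoc, eg_mul_iotaA_mul_e0, mul_assoc, hb, ← mul_assoc,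
      ← eg_mul_iotaA_of_mem h0 hr, map_mul, mul_assoc]
  | zero => exact ⟨0, Submodule.zero_mem _, by simp⟩
  | add y z _ _ hy hz =>
    obtain ⟨a, ha, hya⟩ := hy
    obtain ⟨b, hb, hzb⟩ := hz
    exact ⟨a + b, Submodule.add_mem _ ha hb, by rw [mul_add, hya, hzb, map_add, mul_add]⟩
  | neg y _ hy =>
    obtain ⟨a, ha, hya⟩ := hy
    exact ⟨-a, Submodule.neg_mem _ ha,
      ((mul_neg _ y).trans ((congrArg Neg.neg hya).trans (mul_neg _ _).symm)).trans
        (congrArg _ (map_neg _ a).symm)⟩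

end

end NCIS

open NCIS in
/-- Lemma 3.2(1): for `1 ≤ j ≤ n−1` (i.e. `j ≠ 0` in `ℤ/n`), the
intersection `e_j(A#C_n) ∩ (e₀)` equals `{e_j a : a ∈ R_j A}`, where `R_j A` is the right
ideal of `A` generated by the isotypic component `R_j`. -/
theorem e_mul_inter_ideal_e0_eq
    (k : Type*) [Field k] [IsAlgClosed k] [CharZero k]
    (n : ℕ) (hn2 : 2 ≤ n) (ω : k) (hω : IsPrimitiveRoot ω n)
    (j : ZMod n) (hj : j ≠ 0) :
    {y : SkewGroup k n | ∃ z : SkewGroup k n, y = eg k n ω j * z} ∩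
        {y : SkewGroup k n | y ∈ TwoSidedIdeal.span {e0 k n}} =
      {y : SkewGroup k n | ∃ a ∈ RcompA k n ω j, y = eg k n ω j * iotaA k n a} := by
  have hn : n ≠ 0 := by lia
  have hnk : (n : k) ≠ 0 := Nat.cast_ne_zero.2 hn
  ext y
  constructor
  · rintro ⟨⟨z, rfl⟩, hy⟩
    obtain ⟨a, ha, h⟩ := exists_eg_mul_eq_of_mem_span hω.pow_eq_one hn j hy
    rw [← mul_assoc, eg_mul_self hω.pow_eq_one hnk] at h
    exact ⟨a, ha, h⟩
  · rintro ⟨a, ha, rfl⟩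
    exact ⟨⟨_, rfl⟩, eg_mul_iotaA_mem_span (hω.ne_zero hn) ha⟩
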